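/- arXiv:1006.3277 — 2 statements merged into one kernel-verified Lean document; each statement's English description precedes it below -/
import Mathlib

section
/- (Axelsson) Let V be an n-dimensional real inner product space, let A, B : V → V be symmetric positive definite linear maps, let b ∈ V, let u be the solution of Au = b, and let (u_k)_{k≥0} be a PCG sequence for (A,B,b) with initial guess u_0. Suppose the spectrum σ(BA) of BA is the disjoint union σ_0 ∪ σ_1, where σ_0 has exactly m elements and σ_1 ⊆ [α, β] with 0 < α ≤ β. Set K = max over λ ∈ σ_1 of the product over μ ∈ σ_0 of |1 − λ/μ|. Then for every k ≥ m, ‖u − u_k‖_A ≤ 2K · ( (√(β/α) − 1)/(√(β/α) + 1) )^{k−m} · ‖u − u_0‖_A. -/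
open scoped RealInnerProductSpace

/-- The energy norm `‖w‖_A := √⟪A w, w⟫` associated with a (symmetric positive definite)
linear map `A` on a real inner product space. -/
noncomputable def Anorm {V : Type*} [NormedAddCommGroup V] [InnerProductSpace ℝ V]
    (A : V →ₗ[ℝ] V) (w : V) : ℝ :=
  Real.sqrt ⟪A w, w⟫

/-- A sequence `useq` is a PCG sequence for `(A, B, b)` with initial guess `useq 0` if for
every `k`, `‖u - useq k‖_A` is the minimum of `‖p(BA)(u - useq 0)‖_A` over all real
polynomials `p` of degree at most `k` with `p(0) = 1`, where `u` solves `A u = b`. -/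
def IsPCGSequence {V : Type*} [NormedAddCommGroup V] [InnerProductSpace ℝ V]
    (A B : V →ₗ[ℝ] V) (u : V) (useq : ℕ → V) : Prop :=
  ∀ k : ℕ,
    IsLeast
      {x : ℝ | ∃ p : Polynomial ℝ, p.natDegree ≤ k ∧ p.eval 0 = 1 ∧
        x = Anorm A ((Polynomial.aeval (B ∘ₗ A) p) (u - useq 0))}
      (Anorm A (u - useq k))

open Polynomial in
theorem LinearMap.IsSymmetric.norm_aeval_apply_le {E : Type*} [NormedAddCommGroup E]
    [InnerProductSpace ℝ E] [FiniteDimensional ℝ E] {T : E →ₗ[ℝ] E} (hT : T.IsSymmetric)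
    (p : ℝ[X]) {M : ℝ} (hM0 : 0 ≤ M)
    (hM : ∀ μ : ℝ, Module.End.HasEigenvalue T μ → |p.eval μ| ≤ M) (x : E) :
    ‖aeval T p x‖ ≤ M * ‖x‖ := by
  set e := hT.eigenvectorBasis rfl
  have hpow : ∀ i (k : ℕ), ⟪e i, (T ^ k) x⟫ = hT.eigenvalues rfl i ^ k * ⟪e i, x⟫ := by
    intro i k
    induction k with
    | zero => simp
    | succ k ih =>
      rw [pow_succ', Module.End.mul_apply, ← hT, hT.apply_eigenvectorBasis, inner_smul_left, ih,
        pow_succ', mul_assoc]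
      rfl
  have hinner : ∀ i, ⟪e i, aeval T p x⟫ = p.eval (hT.eigenvalues rfl i) * ⟪e i, x⟫ := by
    intro i
    rw [aeval_eq_sum_range, eval_eq_sum_range, LinearMap.sum_apply, inner_sum, Finset.sum_mul]
    refine Finset.sum_congr rfl fun k _ => ?_
    rw [LinearMap.smul_apply, inner_smul_right, hpow, mul_assoc]
  refine le_of_sq_le_sq ?_ (by positivity)
  rw [mul_pow, ← e.sum_sq_norm_inner_right, ← e.sum_sq_norm_inner_right, Finset.mul_sum]
  refine Finset.sum_le_sum fun i _ => ?_
  rw [hinner, norm_mul, mul_pow]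
  gcongr
  exact hM _ (hT.hasEigenvalue_eigenvalues rfl i)

open Polynomial in
theorem InnerProductSpace.Core.inner_aeval_apply_self_le {V : Type*} [AddCommGroup V] [Module ℝ V]
    [FiniteDimensional ℝ V] (c : InnerProductSpace.Core ℝ V) {T : V →ₗ[ℝ] V}
    (hT : ∀ v w, c.inner (T v) w = c.inner v (T w)) (p : ℝ[X]) {M : ℝ} (hM0 : 0 ≤ M)
    (hM : ∀ μ : ℝ, Module.End.HasEigenvalue T μ → |p.eval μ| ≤ M) (x : V) :
    √(c.inner (aeval T p x) (aeval T p x)) ≤ M * √(c.inner x x) := by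
  let _ : NormedAddCommGroup V := c.toNormedAddCommGroup
  let _ : InnerProductSpace ℝ V := InnerProductSpace.ofCore c.toCore
  exact LinearMap.IsSymmetric.norm_aeval_apply_le (T := T) hT p hM0 hM x

open Polynomial in
theorem Anorm_aeval_apply_le {V : Type*} [NormedAddCommGroup V] [InnerProductSpace ℝ V]
    [FiniteDimensional ℝ V] {A T : V →ₗ[ℝ] V} (hAsym : ∀ u v : V, ⟪A u, v⟫ = ⟪u, A v⟫)
    (hApos : ∀ v : V, v ≠ 0 → 0 < ⟪A v, v⟫) (hT : ∀ u v : V, ⟪A (T u), v⟫ = ⟪A u, T v⟫)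
    (p : ℝ[X]) {M : ℝ} (hM0 : 0 ≤ M)
    (hM : ∀ μ : ℝ, Module.End.HasEigenvalue T μ → |p.eval μ| ≤ M) (x : V) :
    Anorm A (aeval T p x) ≤ M * Anorm A x := by
  let c : InnerProductSpace.Core ℝ V :=
    { inner := fun v w => ⟪A v, w⟫
      conj_inner_symm := fun v w => by
        rw [conj_trivial, hAsym, real_inner_comm]
      re_inner_nonneg := fun v => by
        rcases eq_or_ne v 0 with rfl | hv
        · simp
        · exact (hApos v hv).le
      add_left := fun v w z => by rw [map_add, inner_add_left]
      smul_left := fun v w r => by rw [map_smul, inner_smul_left]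
      definite := fun v hv => by
        by_contra h
        exact (hApos v h).ne' hv }
  exact c.inner_aeval_apply_self_le hT p hM0 hM x

open Polynomial Polynomial.Chebyshev in
theorem exists_polynomial_abs_eval_le_on_Icc {α β : ℝ} (hα : 0 < α) (hαβ : α ≤ β) (j : ℕ) :
    ∃ q : ℝ[X], q.natDegree ≤ j ∧ q.eval 0 = 1 ∧ ∀ x ∈ Set.Icc α β,
      |q.eval x| ≤ 2 * ((√(β / α) - 1) / (√(β / α) + 1)) ^ j := by
  rcases hαβ.eq_or_lt with rfl | hlt
  · refine ⟨(1 - C α⁻¹ * X) ^ j, ?_, by simp, fun x hx => ?_⟩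
    · compute_degree
    · obtain rfl : x = α := le_antisymm hx.2 hx.1
      rcases j.eq_zero_or_pos with rfl | hj
      · simp
      · simp [hα.ne', hj.ne']
  set s := √(β / α)
  have hs : 1 < s := by
    rw [Real.lt_sqrt one_pos.le, one_pow, one_lt_div hα]
    exact hlt
  have hβ : β = s ^ 2 * α := by
    rw [Real.sq_sqrt (div_pos (hα.trans hlt) hα).le, div_mul_cancel₀ _ hα.ne']
  have hd : 0 < β - α := sub_pos.2 hlt
  have hs1 : 0 < s - 1 := sub_pos.2 hs
  set r := (s - 1) / (s + 1) with hr
  have hr0 : 0 < r := by positivity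
  set y := (β + α) / (β - α) with hy
  have hcosh : y = Real.cosh (Real.log r⁻¹) := by
    rw [Real.cosh_log (inv_pos.2 hr0), inv_inv, hy, hβ, hr]
    have : s ^ 2 * α - α ≠ 0 := by rw [← hβ]; exact hd.ne'
    field_simp
    have : s ^ 2 - 1 ≠ 0 := by nlinarith
    field_simp
    ring
  have hT : r⁻¹ ^ j / 2 ≤ (T ℝ j).eval y := by
    rw [hcosh, T_real_cosh, Real.cosh_eq, Int.cast_natCast, Real.exp_nat_mul,
      Real.exp_log (inv_pos.2 hr0)]
    have := Real.exp_pos (-(j * Real.log r⁻¹))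
    linarith
  have hT0 : 0 < (T ℝ j).eval y := lt_of_lt_of_le (by positivity) hT
  refine ⟨C ((T ℝ j).eval y)⁻¹ * (T ℝ j).comp (C y - C (2 / (β - α)) * X), ?_, ?_, fun x hx => ?_⟩
  · refine (natDegree_C_mul_le _ _).trans (natDegree_comp_le.trans ?_)
    rw [natDegree_T, Int.natAbs_natCast]
    refine (Nat.mul_le_mul_left j (?_ : _ ≤ 1)).trans (mul_one j).le
    compute_degree
  · simp [hT0.ne']
  · have hle : |y - 2 / (β - α) * x| ≤ 1 := by
      have : y - 2 / (β - α) * x = (β + α - 2 * x) / (β - α) := by rw [hy]; ring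
      rw [this, abs_div, abs_of_pos hd, div_le_one hd, abs_le]
      constructor <;> linarith [hx.1, hx.2]
    have h1 := abs_eval_T_real_le_one j hle
    have h2 : ((T ℝ j).eval y)⁻¹ ≤ 2 * r ^ j := by
      rw [inv_le_comm₀ hT0 (by positivity)]
      refine le_of_eq_of_le ?_ hT
      rw [mul_inv, inv_pow]
      ring
    simp only [eval_mul, eval_C, eval_comp, eval_sub, eval_X]
    rw [abs_mul, abs_of_pos (inv_pos.2 hT0)]
    exact (mul_le_of_le_one_right (inv_pos.2 hT0).le h1).trans h2

/-- **(Axelsson).** Let `A, B` be symmetric positive definite linear maps on an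
`n`-dimensional real inner product space `V`, let `u` solve `A u = b`, and let `useq` be a
PCG sequence for `(A, B, b)` with initial guess `useq 0`.  Suppose the spectrum of `B ∘ A`
is the disjoint union `σ₀ ∪ σ₁` where `σ₀` has exactly `m` elements and `σ₁ ⊆ [α, β]` with
`0 < α ≤ β`, and set `K = max_{λ ∈ σ₁} ∏_{μ ∈ σ₀} |1 - λ/μ|`.  Then for every `k ≥ m`,
`‖u - u_k‖_A ≤ 2 K ((√(β/α) - 1)/(√(β/α) + 1))^(k-m) ‖u - u₀‖_A`. -/
theorem pcg_convergence_clustered_eigenvalues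
    {V : Type*} [NormedAddCommGroup V] [InnerProductSpace ℝ V] [FiniteDimensional ℝ V]
    {n : ℕ} (hn : Module.finrank ℝ V = n)
    (A B : V →ₗ[ℝ] V)
    (hAsym : ∀ u v : V, ⟪A u, v⟫ = ⟪u, A v⟫)
    (hApos : ∀ v : V, v ≠ 0 → 0 < ⟪A v, v⟫)
    (hBsym : ∀ u v : V, ⟪B u, v⟫ = ⟪u, B v⟫)
    (hBpos : ∀ v : V, v ≠ 0 → 0 < ⟪B v, v⟫)
    (b : V) (u : V) (hu : A u = b)
    (useq : ℕ → V) (hpcg : IsPCGSequence A B u useq)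
    (m : ℕ) (σ₀ : Finset ℝ) (σ₁ : Set ℝ)
    (hspec : {μ : ℝ | Module.End.HasEigenvalue (B ∘ₗ A) μ} = ↑σ₀ ∪ σ₁)
    (hdisj : Disjoint (↑σ₀ : Set ℝ) σ₁)
    (hcard : σ₀.card = m)
    (α β : ℝ) (hα : 0 < α) (hαβ : α ≤ β)
    (hσ₁ : σ₁ ⊆ Set.Icc α β)
    (K : ℝ) (hK : IsGreatest ((fun l => ∏ μ ∈ σ₀, |1 - l / μ|) '' σ₁) K) :
    ∀ k : ℕ, m ≤ k →
      Anorm A (u - useq k) ≤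
        2 * K * ((Real.sqrt (β / α) - 1) / (Real.sqrt (β / α) + 1)) ^ (k - m) *
          Anorm A (u - useq 0) := by
  intro k hk
  have hBA : ∀ v w : V, ⟪A ((B ∘ₗ A) v), w⟫ = ⟪A v, (B ∘ₗ A) w⟫ := fun v w => by
    simp only [LinearMap.comp_apply, hAsym, hBsym]
  have hpos : ∀ μ : ℝ, Module.End.HasEigenvalue (B ∘ₗ A) μ → μ ≠ 0 := by
    rintro μ hμ rfl
    obtain ⟨v, hv⟩ := hμ.exists_hasEigenvector
    have hBAv : B (A v) = 0 := by simpa using hv.apply_eq_smul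
    have hAv : A v ≠ 0 := fun h => by simpa [h] using hApos v hv.2
    simpa [hBAv] using hBpos (A v) hAv
  obtain ⟨q, hqdeg, hq0, hq⟩ := exists_polynomial_abs_eval_le_on_Icc hα hαβ (k - m)
  set r := (√(β / α) - 1) / (√(β / α) + 1)
  have hr : 0 ≤ r := div_nonneg
    (sub_nonneg.2 (Real.one_le_sqrt.2 ((one_le_div hα).2 hαβ))) (by positivity)
  have hK0 : 0 ≤ K := by
    obtain ⟨l, -, rfl⟩ := hK.1
    exact Finset.prod_nonneg fun _ _ => abs_nonneg _
  set p : Polynomial ℝ := (∏ μ ∈ σ₀, (1 - Polynomial.C μ⁻¹ * Polynomial.X)) * q with hp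
  have heval : ∀ x, p.eval x = (∏ μ ∈ σ₀, (1 - x / μ)) * q.eval x := fun x => by
    simp [hp, Polynomial.eval_prod, div_eq_inv_mul]
  have hdeg : p.natDegree ≤ k := by
    refine Polynomial.natDegree_mul_le.trans ?_
    have hprod : (∏ μ ∈ σ₀, (1 - Polynomial.C μ⁻¹ * Polynomial.X)).natDegree ≤ m := by
      refine (Polynomial.natDegree_prod_le _ _).trans ?_
      rw [← hcard, Finset.card_eq_sum_ones]
      exact Finset.sum_le_sum fun μ _ => by compute_degree
    omega
  have hbound : ∀ l : ℝ, Module.End.HasEigenvalue (B ∘ₗ A) l →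
      |p.eval l| ≤ 2 * K * r ^ (k - m) := by
    intro l hl
    have hmem : l ∈ (↑σ₀ ∪ σ₁ : Set ℝ) := hspec ▸ hl
    rw [heval]
    rcases hmem with h | h
    · rw [Finset.prod_eq_zero h (by rw [div_self (hpos l hl), sub_self]), zero_mul, abs_zero]
      positivity
    · rw [abs_mul, Finset.abs_prod]
      calc _ ≤ K * (2 * r ^ (k - m)) :=
            mul_le_mul (hK.2 ⟨l, h, rfl⟩) (hq l (hσ₁ h)) (abs_nonneg _) hK0
        _ = _ := by ring
  exact ((hpcg k).2 ⟨p, hdeg, by simp [heval, hq0], rfl⟩).trans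
    (Anorm_aeval_apply_le hAsym hApos hBA p (by positivity) hbound _)
end

section
/- Let σ_0 be a finite set of m strictly positive real numbers and let 0 < α ≤ β. Then for every integer k ≥ m there exists a real polynomial p with deg p ≤ k, p(0) = 1, and p(μ) = 0 for every μ ∈ σ_0, such that for all λ ∈ [α, β], |p(λ)| ≤ 2K · ( (√(β/α) − 1)/(√(β/α) + 1) )^{k−m}, where K = sup over λ ∈ [α, β] of the product over μ ∈ σ_0 of |1 − λ/μ|. -/
open Polynomial in
theorem Polynomial.Chebyshev.pow_le_two_mul_eval_T_real {y : ℝ} (hy : 0 < y) (n : ℕ) :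
    y ^ n ≤ 2 * (T ℝ n).eval ((y + y⁻¹) / 2) := by
  have h : (T ℝ n).eval ((y + y⁻¹) / 2) = (y ^ n + (y ^ n)⁻¹) / 2 := by
    rw [← Real.cosh_log hy, T_real_cosh, ← Real.cosh_log (pow_pos hy n), Real.log_pow]
    norm_cast
  have : 0 < (y ^ n)⁻¹ := by positivity
  linarith

open Polynomial Polynomial.Chebyshev in
/-- A rescaled Chebyshev polynomial, normalized at `0`, which is small on `[α, β]`. -/
theorem exists_polynomial_eval_zero_eq_one_abs_le {α β : ℝ} (hα : 0 < α) (hαβ : α ≤ β) (n : ℕ) :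
    ∃ q : ℝ[X], q.natDegree ≤ n ∧ q.eval 0 = 1 ∧ ∀ l ∈ Set.Icc α β,
      |q.eval l| ≤ 2 * ((Real.sqrt (β / α) - 1) / (Real.sqrt (β / α) + 1)) ^ n := by
  rcases hαβ.eq_or_lt with rfl | hlt
  · refine ⟨(1 - C α⁻¹ * X) ^ n, ?_, by simp, fun l hl => ?_⟩
    · refine natDegree_pow_le_of_le n (m := 1) ?_ |>.trans_eq (mul_one n)
      compute_degree
    · obtain rfl : l = α := le_antisymm hl.2 hl.1
      rcases n with _ | n <;> simp [hα.ne']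
  set s := Real.sqrt (β / α) with hs
  have hs1 : 1 < s := by
    rw [hs, Real.lt_sqrt zero_le_one, one_pow]
    exact (one_lt_div hα).2 hlt
  have hβ : β = α * s ^ 2 := by
    rw [hs, Real.sq_sqrt (div_nonneg (hα.le.trans hαβ) hα.le), mul_div_cancel₀ _ hα.ne']
  have hsm : 0 < s - 1 := sub_pos.2 hs1
  have hd : 0 < β - α := sub_pos.2 hlt
  set y := (s + 1) / (s - 1) with hy
  have hy0 : 0 < y := by positivity
  have hx : (y + y⁻¹) / 2 = (β + α) / (β - α) := by
    have h2 : β - α = α * ((s - 1) * (s + 1)) := by rw [hβ]; ring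
    rw [h2, hy, hβ]
    field_simp
    ring
  have hT := pow_le_two_mul_eval_T_real hy0 n
  rw [hx] at hT
  have hyn : 0 < y ^ n := pow_pos hy0 n
  set t := (T ℝ n).eval ((β + α) / (β - α)) with ht
  have ht0 : 0 < t := by linarith
  refine ⟨C t⁻¹ * (T ℝ n).comp (C ((β + α) / (β - α)) - C (2 / (β - α)) * X), ?_, ?_, ?_⟩
  · refine (natDegree_C_mul_le _ _).trans (natDegree_comp_le.trans ?_)
    have h1 : (C ((β + α) / (β - α)) - C (2 / (β - α)) * X).natDegree ≤ 1 := by compute_degree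
    simpa using Nat.mul_le_mul_left n h1
  · simp [← ht, ht0.ne']
  · intro l hl
    have hle : |(T ℝ n).eval ((β + α) / (β - α) - 2 / (β - α) * l)| ≤ 1 := by
      apply abs_eval_T_real_le_one
      have h : (β + α) / (β - α) - 2 / (β - α) * l = (β + α - 2 * l) / (β - α) := by ring
      rw [h, abs_div, abs_of_pos hd, div_le_one hd, abs_le]
      constructor <;> linarith [hl.1, hl.2]
    have hr : ((s - 1) / (s + 1)) ^ n = (y ^ n)⁻¹ := by rw [hy, ← inv_pow, inv_div]
    rw [hr]
    simp only [eval_mul, eval_C, eval_comp, eval_sub, eval_X, abs_mul, abs_inv, abs_of_pos ht0]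
    calc t⁻¹ * _ ≤ t⁻¹ * 1 := by gcongr
      _ ≤ 2 * (y ^ n)⁻¹ := by
        rw [mul_one, ← div_eq_mul_inv, inv_eq_one_div, div_le_div_iff₀ ht0 hyn]
        linarith


/-- Let `σ₀` be a finite set of `m` strictly positive real numbers and let `0 < α ≤ β`.
Then for every `k ≥ m` there exists a real polynomial `p` with `deg p ≤ k`, `p(0) = 1` and
`p(μ) = 0` for every `μ ∈ σ₀`, such that for all `λ ∈ [α, β]`,
`|p(λ)| ≤ 2 K ((√(β/α) - 1)/(√(β/α) + 1))^(k-m)`, where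
`K = sup_{λ ∈ [α,β]} ∏_{μ ∈ σ₀} |1 - λ/μ|`. -/
theorem exists_pcg_polynomial
    (σ₀ : Finset ℝ) (m : ℕ) (hcard : σ₀.card = m) (hσ₀pos : ∀ μ ∈ σ₀, 0 < μ)
    (α β : ℝ) (hα : 0 < α) (hαβ : α ≤ β)
    (K : ℝ) (hK : K = ⨆ l : Set.Icc α β, ∏ μ ∈ σ₀, |1 - (l : ℝ) / μ|) :
    ∀ k : ℕ, m ≤ k →
      ∃ p : Polynomial ℝ,
        p.natDegree ≤ k ∧ p.eval 0 = 1 ∧ (∀ μ ∈ σ₀, p.eval μ = 0) ∧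
        ∀ l ∈ Set.Icc α β,
          |p.eval l| ≤
            2 * K * ((Real.sqrt (β / α) - 1) / (Real.sqrt (β / α) + 1)) ^ (k - m) := by
  intro k hk
  obtain ⟨q, hqdeg, hq0, hq⟩ := exists_polynomial_eval_zero_eq_one_abs_le hα hαβ (k - m)
  refine ⟨(∏ μ ∈ σ₀, (1 - Polynomial.C μ⁻¹ * Polynomial.X)) * q, ?_, ?_, ?_, ?_⟩
  · have hdeg : (∏ μ ∈ σ₀, (1 - Polynomial.C μ⁻¹ * Polynomial.X)).natDegree ≤ m := by
      refine (Polynomial.natDegree_prod_le _ _).trans ?_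
      rw [← hcard, Finset.card_eq_sum_ones]
      refine Finset.sum_le_sum fun μ _ => ?_
      compute_degree
    exact Polynomial.natDegree_mul_le.trans (by omega)
  · simp [Polynomial.eval_prod, hq0]
  · intro μ hμ
    rw [Polynomial.eval_mul, Polynomial.eval_prod, Finset.prod_eq_zero hμ, zero_mul]
    simp [(hσ₀pos μ hμ).ne']
  · intro l hl
    have hbdd : BddAbove (Set.range fun l : Set.Icc α β => ∏ μ ∈ σ₀, |1 - (l : ℝ) / μ|) :=
      (isCompact_range (by fun_prop)).bddAbove
    have hlK : ∏ μ ∈ σ₀, |1 - l / μ| ≤ K := hK ▸ le_ciSup hbdd ⟨l, hl⟩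
    have hP : |(∏ μ ∈ σ₀, (1 - Polynomial.C μ⁻¹ * Polynomial.X)).eval l| ≤ K := by
      simpa [Polynomial.eval_prod, Finset.abs_prod, div_eq_inv_mul] using hlK
    rw [Polynomial.eval_mul, abs_mul]
    refine (mul_le_mul hP (hq l hl) (abs_nonneg _) ((abs_nonneg _).trans hP)).trans_eq ?_
    ring
end
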